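/- The gradient ${\rm grad}\,J_\mathcal{O}(S)=(2I_{N^3}-SS^\dagger)(I_{N^2}\otimes\mathcal{O})S\rho - S\rho S^\dagger(I_{N^2}\otimes\mathcal{O})S$ is tangent to the Stiefel manifold at $S$: if $S^\dagger S=I_N$ and $\rho,\mathcal{O}$ are Hermitian, then $S^\dagger\,{\rm grad}\,J_\mathcal{O}(S) + ({\rm grad}\,J_\mathcal{O}(S))^\dagger S = 0$. -/

import Mathlib

open Matrix Kronecker

/-- The gradient of the objective `J_O` on the complex Stiefel manifold. -/
noncomputable def gradJ (N : ℕ) (ρ O : Matrix (Fin N) (Fin N) ℂ)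
    (S : Matrix (Fin (N ^ 2) × Fin N) (Fin N) ℂ) :
    Matrix (Fin (N ^ 2) × Fin N) (Fin N) ℂ :=
  ((2 : ℂ) • (1 : Matrix (Fin (N ^ 2) × Fin N) (Fin (N ^ 2) × Fin N) ℂ) - S * Sᴴ)
      * ((1 : Matrix (Fin (N ^ 2)) (Fin (N ^ 2)) ℂ) ⊗ₖ O) * S * ρ
    - S * ρ * Sᴴ * ((1 : Matrix (Fin (N ^ 2)) (Fin (N ^ 2)) ℂ) ⊗ₖ O) * S

theorem grad_tangent_to_stiefel (N : ℕ) (hN : 1 ≤ N)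
    (ρ O : Matrix (Fin N) (Fin N) ℂ) (hρ : ρ.IsHermitian) (hO : O.IsHermitian)
    (S : Matrix (Fin (N ^ 2) × Fin N) (Fin N) ℂ)
    (hS : Sᴴ * S = (1 : Matrix (Fin N) (Fin N) ℂ)) :
    Sᴴ * gradJ N ρ O S + (gradJ N ρ O S)ᴴ * S = 0 := by
  have hK : ((1 : Matrix (Fin (N ^ 2)) (Fin (N ^ 2)) ℂ) ⊗ₖ O)ᴴ
      = (1 : Matrix (Fin (N ^ 2)) (Fin (N ^ 2)) ℂ) ⊗ₖ O := by
    rw [conjTranspose_kronecker, conjTranspose_one, hO.eq]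
  have key : Sᴴ * gradJ N ρ O S
      = Sᴴ * ((1 : Matrix (Fin (N ^ 2)) (Fin (N ^ 2)) ℂ) ⊗ₖ O) * S * ρ
        - ρ * (Sᴴ * ((1 : Matrix (Fin (N ^ 2)) (Fin (N ^ 2)) ℂ) ⊗ₖ O) * S) := by
    unfold gradJ
    generalize (1 : Matrix (Fin (N ^ 2)) (Fin (N ^ 2)) ℂ) ⊗ₖ O = K
    have h (X : Matrix (Fin N) (Fin N) ℂ) : Sᴴ * (S * X) = X := by
      rw [← Matrix.mul_assoc, hS, Matrix.one_mul]
    simp only [Matrix.mul_sub, Matrix.sub_mul, Matrix.mul_assoc, h, Matrix.add_mul,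
      Matrix.mul_add, Matrix.one_mul, two_smul]
    abel
  have key2 : (gradJ N ρ O S)ᴴ * S = (Sᴴ * gradJ N ρ O S)ᴴ := by
    rw [conjTranspose_mul, conjTranspose_conjTranspose]
  rw [key2, key]
  simp only [conjTranspose_sub, conjTranspose_mul, conjTranspose_conjTranspose, hK, hρ.eq,
    Matrix.mul_assoc]
  abel
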